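/- arXiv:2509.20747 — 2 statements merged into one kernel-verified Lean document; each statement's English description precedes it below -/
import Mathlib

section
/- For every Δt > 0 and every f : Ω_h → ℝ there exists a function u : Ω_h → ℝ solving the discrete resolvent problem with data f, i.e. u(x) − Δt·(H_h u)(x) = f(x) for all x ∈ Ω_h, and this solution satisfies min_{y ∈ Ω_h} f(y) ≤ u(x) ≤ max_{y ∈ Ω_h} f(y) for all x ∈ Ω_h. -/
open scoped Classical BigOperators
open MeasureTheory

noncomputable section

/-- Shift a grid point `x` by the integer vector `ν` scaled by `h`. -/
def shiftPt {N : ℕ} (h : ℝ) (x : Fin N → ℝ) (ν : Fin N → ℤ) : Fin N → ℝ :=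
  fun k => x k + (ν k : ℝ) * h

/-- The state-constrained discrete Hamiltonian `H_h`. -/
def discHam {N M : ℕ} (h : ℝ) (Ωh : Finset (Fin N → ℝ)) (ν : Fin M → Fin N → ℤ)
    (Φp Φm : Fin M → (Fin N → ℝ) → ℝ) (u : (Fin N → ℝ) → ℝ) (x : Fin N → ℝ) : ℝ :=
  ∑ j : Fin M,
    ((if shiftPt h x (ν j) ∈ Ωh then
        Φp j x * (Real.exp ((u (shiftPt h x (ν j)) - u x) / h) - 1) else 0)
      + (if shiftPt h x (-(ν j)) ∈ Ωh then
        Φm j x * (Real.exp ((u (shiftPt h x (-(ν j))) - u x) / h) - 1) else 0))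

/-- The Hamiltonian with the value at the centre decoupled. -/
def resG {N M : ℕ} (h : ℝ) (Ωh : Finset (Fin N → ℝ)) (ν : Fin M → Fin N → ℤ)
    (Φp Φm : Fin M → (Fin N → ℝ) → ℝ) (w : (Fin N → ℝ) → ℝ) (x : Fin N → ℝ) (s : ℝ) : ℝ :=
  ∑ j : Fin M,
    ((if shiftPt h x (ν j) ∈ Ωh then
        Φp j x * (Real.exp ((w (shiftPt h x (ν j)) - s) / h) - 1) else 0)
      + (if shiftPt h x (-(ν j)) ∈ Ωh then
        Φm j x * (Real.exp ((w (shiftPt h x (-(ν j))) - s) / h) - 1) else 0))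

theorem resG_mono {N M : ℕ} {h : ℝ} (hh : 0 < h) (Ωh : Finset (Fin N → ℝ))
    (ν : Fin M → Fin N → ℤ) (Φp Φm : Fin M → (Fin N → ℝ) → ℝ)
    {w w' : (Fin N → ℝ) → ℝ} {x : Fin N → ℝ} {s s' : ℝ}
    (hp : ∀ j, 0 ≤ Φp j x) (hm : ∀ j, 0 ≤ Φm j x)
    (hw : ∀ y, w y - s ≤ w' y - s') :
    resG h Ωh ν Φp Φm w x s ≤ resG h Ωh ν Φp Φm w' x s' := by
  unfold resG
  refine Finset.sum_le_sum fun j _ => add_le_add ?_ ?_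
  · split_ifs
    · refine mul_le_mul_of_nonneg_left (sub_le_sub_right (Real.exp_le_exp.2 ?_) _) (hp j)
      exact div_le_div_of_nonneg_right (hw _) hh.le
    · exact le_rfl
  · split_ifs
    · refine mul_le_mul_of_nonneg_left (sub_le_sub_right (Real.exp_le_exp.2 ?_) _) (hm j)
      exact div_le_div_of_nonneg_right (hw _) hh.le
    · exact le_rfl

theorem resG_const {N M : ℕ} (h : ℝ) (Ωh : Finset (Fin N → ℝ))
    (ν : Fin M → Fin N → ℤ) (Φp Φm : Fin M → (Fin N → ℝ) → ℝ)
    (x : Fin N → ℝ) (s : ℝ) : resG h Ωh ν Φp Φm (fun _ => s) x s = 0 := by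
  simp [resG]

theorem resG_cont {N M : ℕ} (h : ℝ) (Ωh : Finset (Fin N → ℝ))
    (ν : Fin M → Fin N → ℤ) (Φp Φm : Fin M → (Fin N → ℝ) → ℝ)
    (w : (Fin N → ℝ) → ℝ) (x : Fin N → ℝ) : Continuous (resG h Ωh ν Φp Φm w x) := by
  unfold resG
  refine continuous_finsetSum _ fun j _ => Continuous.add ?_ ?_
  · split_ifs <;> fun_prop
  · split_ifs <;> fun_prop

/-- **Existence of the discrete resolvent problem** `u - Δt·H_h u = f` on `Ω_h`,
together with the min/max bounds by the data. -/
theorem discrete_resolvent_existence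
    {N M : ℕ} (hN : 0 < N) (hM : 0 < M)
    (h : ℝ) (hh : 0 < h)
    (Ω : Set (Fin N → ℝ)) (hΩo : IsOpen Ω) (hΩne : Ω.Nonempty)
    (hΩbd : Bornology.IsBounded Ω)
    (hΩpos : closure Ω ⊆ {x : Fin N → ℝ | ∀ k, 0 < x k})
    (ν : Fin M → Fin N → ℤ)
    (Φp Φm : Fin M → (Fin N → ℝ) → ℝ)
    (hΦpc : ∀ j, ContinuousOn (Φp j) (closure Ω))
    (hΦmc : ∀ j, ContinuousOn (Φm j) (closure Ω))
    (hΦp0 : ∀ j, ∀ x ∈ closure Ω, 0 ≤ Φp j x)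
    (hΦm0 : ∀ j, ∀ x ∈ closure Ω, 0 ≤ Φm j x)
    (Ωh : Finset (Fin N → ℝ))
    (hΩh : ∀ x : Fin N → ℝ,
      x ∈ Ωh ↔ ((∃ i : Fin N → ℕ, ∀ k, x k = (i k : ℝ) * h) ∧ x ∈ closure Ω))
    (hne : Ωh.Nonempty)
    (Δt : ℝ) (hΔt : 0 < Δt) (f : (Fin N → ℝ) → ℝ) :
    ∃ u : (Fin N → ℝ) → ℝ,
      (∀ x ∈ Ωh, u x - Δt * discHam h Ωh ν Φp Φm u x = f x) ∧
      (∀ x ∈ Ωh, Ωh.inf' hne f ≤ u x ∧ u x ≤ Ωh.sup' hne f) := by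
  have hp : ∀ x ∈ Ωh, ∀ j, 0 ≤ Φp j x := fun x hx j => hΦp0 j x ((hΩh x).1 hx).2
  have hm : ∀ x ∈ Ωh, ∀ j, 0 ≤ Φm j x := fun x hx j => hΦm0 j x ((hΩh x).1 hx).2
  obtain ⟨a, ha⟩ : ∃ a, a = Ωh.inf' hne f := ⟨_, rfl⟩
  obtain ⟨b, hb⟩ : ∃ b, b = Ωh.sup' hne f := ⟨_, rfl⟩
  rw [← ha, ← hb]
  have haf : ∀ x ∈ Ωh, a ≤ f x := fun x hx => ha ▸ Finset.inf'_le f hx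
  have hbf : ∀ x ∈ Ωh, f x ≤ b := fun x hx => hb ▸ Finset.le_sup' f hx
  have hab : a ≤ b := by
    obtain ⟨x, hx⟩ := hne
    exact (haf x hx).trans (hbf x hx)
  have key : ∀ (w : (Fin N → ℝ) → Set.Icc a b) (x : Fin N → ℝ), ∃ s : Set.Icc a b,
      (x ∈ Ωh → (s : ℝ) - Δt * resG h Ωh ν Φp Φm (fun y => (w y : ℝ)) x s = f x) ∧
      (x ∉ Ωh → (s : ℝ) = a) := by
    intro w x
    by_cases hx : x ∈ Ωh
    · have hc : Continuous
          (fun s : ℝ => s - Δt * resG h Ωh ν Φp Φm (fun y => (w y : ℝ)) x s) :=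
        continuous_id.sub (continuous_const.mul (resG_cont h Ωh ν Φp Φm _ x))
      have h1 : 0 ≤ resG h Ωh ν Φp Φm (fun y => (w y : ℝ)) x a := by
        rw [← resG_const h Ωh ν Φp Φm x a]
        exact resG_mono hh Ωh ν Φp Φm (hp x hx) (hm x hx)
          fun y => sub_le_sub_right (w y).2.1 _
      have h2 : resG h Ωh ν Φp Φm (fun y => (w y : ℝ)) x b ≤ 0 := by
        rw [← resG_const h Ωh ν Φp Φm x b]
        exact resG_mono hh Ωh ν Φp Φm (hp x hx) (hm x hx)
          fun y => sub_le_sub_right (w y).2.2 _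
      have := intermediate_value_Icc hab hc.continuousOn
      obtain ⟨s, hs, hs'⟩ := this (show f x ∈ _ from
        ⟨by nlinarith [haf x hx, mul_nonneg hΔt.le h1],
         by nlinarith [hbf x hx, mul_nonneg hΔt.le (neg_nonneg.2 h2)]⟩)
      exact ⟨⟨s, hs⟩, fun _ => hs', fun hn => absurd hx hn⟩
    · exact ⟨⟨a, le_rfl, hab⟩, fun hn => absurd hn hx, fun _ => rfl⟩
  choose T hT hT' using key
  have hmono : Monotone T := by
    intro w w' hw x
    by_cases hx : x ∈ Ωh
    · by_contra hlt
      have hlt' : (T w' x : ℝ) < T w x := lt_of_not_ge hlt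
      have h1 := hT w x hx
      have h2 := hT w' x hx
      have h3 := resG_mono hh Ωh ν Φp Φm (w := fun y => (w y : ℝ))
        (w' := fun y => (w' y : ℝ)) (s := T w x) (s' := T w' x) (hp x hx) (hm x hx)
        fun y => sub_le_sub (hw y) hlt'.le
      nlinarith [mul_le_mul_of_nonneg_left h3 hΔt.le]
    · exact ((hT' w x hx).trans (hT' w' x hx).symm).le
  haveI : Fact (a ≤ b) := ⟨hab⟩
  obtain ⟨u, hu⟩ : ∃ u, T u = u := ⟨OrderHom.lfp ⟨T, hmono⟩, OrderHom.map_lfp ⟨T, hmono⟩⟩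
  refine ⟨fun y => (u y : ℝ), fun x hx => ?_, fun x _ => (u x).2⟩
  have := hT u x hx
  rw [hu] at this
  exact this
end
end

section
/- Let a < b and a_β ≤ a < b_β ≤ b be real numbers with max{|a − a_β|, |b − b_β|} < (b − a)/16, and let α ∈ (a, b) with α ≤ b_β. Let v ∈ L¹_loc([0,∞); ℝ). Suppose (η, l) solves the Skorokhod problem on [a, b] with driver v and initial point α, and (η_β, l_β) solves the Skorokhod problem on [a_β, b_β] with the same driver v and the same initial point α. Then for every s ≥ 0, |η(s) − η_β(s)| ≤ 2·max{|a − a_β|, |b − b_β|}. -/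
open MeasureTheory

noncomputable section

/-- The outward "normal" of the interval `[a, b]`: `−1` at `a`, `1` at `b`
(and `0` in the interior, where the reflection term vanishes anyway). -/
def bdryNormal (a b x : ℝ) : ℝ := if x = a then -1 else if x = b then 1 else 0

/-- `(η, l)` solves the Skorokhod problem on `[a, b]` with driver `v` and initial
point `α`: `η` is (locally absolutely) continuous with `η(0) = α`, given in
integral form by `η(s) = α + ∫₀ˢ (v − l·n(η))`, stays in `[a, b]`, `l ≥ 0` a.e.,
and `l = 0` a.e. on `{a < η < b}`. -/
def SkorokhodSol (a b α : ℝ) (v η l : ℝ → ℝ) : Prop :=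
  η 0 = α ∧
  (∀ s ∈ Set.Ici (0:ℝ), η s ∈ Set.Icc a b) ∧
  MeasureTheory.LocallyIntegrableOn l (Set.Ici 0) MeasureTheory.volume ∧
  (∀ᵐ s ∂(MeasureTheory.volume.restrict (Set.Ici (0:ℝ))), 0 ≤ l s) ∧
  (∀ s ∈ Set.Ici (0:ℝ),
    η s = α + ∫ τ in (0:ℝ)..s, (v τ - l τ * bdryNormal a b (η τ))) ∧
  (∀ᵐ s ∂(MeasureTheory.volume.restrict (Set.Ici (0:ℝ))),
    η s ∈ Set.Ioo a b → l s = 0)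

/-- The primitive of any function (junk or not) is measurable on `[0,∞)`. -/
lemma aux_prim_aemeas (f : ℝ → ℝ) :
    AEMeasurable (fun s => ∫ τ in (0:ℝ)..s, f τ) (volume.restrict (Set.Ici (0:ℝ))) := by
  set I : Set ℝ := {s | 0 ≤ s ∧ IntervalIntegrable f volume 0 s} with hI
  have hord : I.OrdConnected := by
    refine ⟨fun x hx y hy z hz => ⟨hx.1.trans hz.1, ?_⟩⟩
    refine hy.2.mono_set ?_
    rw [Set.uIcc_of_le (hx.1.trans hz.1), Set.uIcc_of_le hy.1]
    exact Set.Icc_subset_Icc_right hz.2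
  have hIm : MeasurableSet I := hord.measurableSet
  have hc : ∀ y ∈ I, ContinuousOn (fun s => ∫ τ in (0:ℝ)..s, f τ) (Set.Icc 0 y) := by
    intro y hy
    have := intervalIntegral.continuousOn_primitive_interval' (μ := volume) hy.2
      (Set.left_mem_uIcc)
    rwa [Set.uIcc_of_le hy.1] at this
  have hcI : ContinuousOn (fun s => ∫ τ in (0:ℝ)..s, f τ) I := by
    intro x hx
    by_cases h : ∃ y ∈ I, x < y
    · obtain ⟨y, hy, hxy⟩ := h
      refine ((hc y hy) x ⟨hx.1, hxy.le⟩).mono_of_mem_nhdsWithin ?_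
      filter_upwards [self_mem_nhdsWithin, mem_nhdsWithin_of_mem_nhds (Iio_mem_nhds hxy)]
        with z hz hz'
      exact ⟨hz.1, le_of_lt hz'⟩
    · push Not at h
      exact ((hc x hx) x ⟨hx.1, le_rfl⟩).mono (fun z hz => ⟨hz.1, h z hz⟩)
  have h1 : AEMeasurable (fun s => ∫ τ in (0:ℝ)..s, f τ) (volume.restrict I) :=
    hcI.aemeasurable hIm
  have h2 : AEMeasurable (fun s => ∫ τ in (0:ℝ)..s, f τ)
      (volume.restrict (Set.Ici 0 \ I)) := by
    refine (aemeasurable_const (b := (0:ℝ))).congr ?_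
    filter_upwards [ae_restrict_mem (measurableSet_Ici.diff hIm)] with s hs
    rw [intervalIntegral.integral_undef]
    exact fun h => hs.2 ⟨hs.1, h⟩
  have h3 := (aemeasurable_union_iff (μ := volume)).2 ⟨h1, h2⟩
  refine h3.mono_measure (Measure.restrict_mono ?_ le_rfl)
  intro s hs
  by_cases h : s ∈ I
  · exact Or.inl h
  · exact Or.inr ⟨hs, h⟩

lemma aux_bdry_meas (a b : ℝ) : Measurable (bdryNormal a b) := by
  unfold bdryNormal
  exact Measurable.ite (measurableSet_singleton a) measurable_const
    (Measurable.ite (measurableSet_singleton b) measurable_const measurable_const)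

lemma aux_bdry_bound (a b x : ℝ) : ‖bdryNormal a b x‖ ≤ 1 := by
  unfold bdryNormal
  split_ifs <;> simp

lemma aux_int {l : ℝ → ℝ} (hl : LocallyIntegrableOn l (Set.Ici 0) volume)
    (s : ℝ) (hs : 0 ≤ s) : IntegrableOn l (Set.Icc 0 s) volume :=
  hl.integrableOn_compact_subset (fun _ h => h.1) isCompact_Icc

lemma aux_sol_int {a b α : ℝ} {v η l : ℝ → ℝ} 
    (hv : LocallyIntegrableOn v (Set.Ici 0) volume)
    (h : SkorokhodSol a b α v η l) (s : ℝ) (hs : 0 ≤ s) :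
    IntervalIntegrable (fun τ => v τ - l τ * bdryNormal a b (η τ)) volume 0 s := by
  obtain ⟨-, -, hl, -, heq, -⟩ := h
  have hη : AEMeasurable η (volume.restrict (Set.Ici (0:ℝ))) := by
    refine ((aux_prim_aemeas
      (fun τ => v τ - l τ * bdryNormal a b (η τ))).const_add α).congr ?_
    filter_upwards [ae_restrict_mem measurableSet_Ici] with s hs
    exact (heq s hs).symm
  have hη' : AEMeasurable η (volume.restrict (Set.Icc (0:ℝ) s)) :=
    hη.mono_measure (Measure.restrict_mono (fun _ h => h.1) le_rfl)
  have hb := ((aux_bdry_meas a b).comp_aemeasurable hη').aestronglyMeasurable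
  rw [intervalIntegrable_iff_integrableOn_Icc_of_le hs]
  refine (aux_int hv s hs).sub ?_
  exact Integrable.mul_bdd (aux_int hl s hs) hb
    (Filter.Eventually.of_forall fun x => aux_bdry_bound a b (η x))

lemma aux_max (w g : ℝ → ℝ) (M : ℝ) (hM : 0 ≤ M)
    (hg : ∀ s, 0 ≤ s → IntervalIntegrable g volume 0 s)
    (hw : ∀ s, 0 ≤ s → w s = ∫ τ in (0:ℝ)..s, g τ)
    (hneg : ∀ᵐ s ∂(volume.restrict (Set.Ici (0:ℝ))), M < w s → g s ≤ 0)
    (s : ℝ) (hs : 0 ≤ s) : w s ≤ M := by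
  by_contra hlt
  push Not at hlt
  have hc : ContinuousOn w (Set.Icc 0 s) := by
    have := intervalIntegral.continuousOn_primitive_interval' (μ := volume) (hg s hs)
      (Set.left_mem_uIcc)
    rw [Set.uIcc_of_le hs] at this
    exact this.congr (fun x hx => hw x hx.1)
  have hK : IsCompact (Set.Icc 0 s ∩ w ⁻¹' Set.Iic M) :=
    isCompact_Icc.of_isClosed_subset (hc.preimage_isClosed_of_isClosed isClosed_Icc isClosed_Iic)
      Set.inter_subset_left
  obtain ⟨t, ⟨⟨ht0, hts⟩, htM⟩, htop⟩ := hK.exists_isGreatest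
    ⟨0, ⟨le_rfl, hs⟩, by simp [hw 0 le_rfl, hM]⟩
  have hd : w s - w t = ∫ τ in t..s, g τ := by
    rw [hw s hs, hw t ht0, intervalIntegral.integral_interval_sub_left (hg s hs) (hg t ht0)]
  have hn : 0 ≤ ∫ τ in t..s, - g τ := by
    rw [intervalIntegral.integral_of_le hts]
    refine integral_nonneg_of_ae ?_
    have h1 := ae_mono (Measure.restrict_mono (μ := volume)
      (fun x hx => ht0.trans hx.1.le : Set.Ioc t s ⊆ Set.Ici (0:ℝ)) le_rfl) hneg
    filter_upwards [h1, ae_restrict_mem measurableSet_Ioc] with x hx hx'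
    have : M < w x := by
      by_contra hcon
      push Not at hcon
      exact absurd (htop ⟨⟨ht0.trans hx'.1.le, hx'.2⟩, hcon⟩) (not_le.2 hx'.1)
    simpa using hx this
  rw [intervalIntegral.integral_neg] at hn
  have : w t ≤ M := htM
  linarith

/-- **Stability of the Skorokhod problem under perturbation of the interval**:
reflected paths on `[a, b]` and on `[a_β, b_β]`, driven by the same `v` and
started from the same interior point `α`, stay within
`2·max{|a − a_β|, |b − b_β|}` of each other for all times. -/
theorem skorokhod_interval_stability
    (a b aβ bβ : ℝ) (hab : a < b)
    (haβ : aβ ≤ a) (hbβ1 : a < bβ) (hbβ2 : bβ ≤ b)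
    (hclose : max |a - aβ| |b - bβ| < (b - a) / 16)
    (α : ℝ) (hα : α ∈ Set.Ioo a b) (hαβ : α ≤ bβ)
    (v : ℝ → ℝ)
    (hv : MeasureTheory.LocallyIntegrableOn v (Set.Ici 0) MeasureTheory.volume)
    (η l ηβ lβ : ℝ → ℝ)
    (hS : SkorokhodSol a b α v η l)
    (hSβ : SkorokhodSol aβ bβ α v ηβ lβ) :
    ∀ s ∈ Set.Ici (0:ℝ), |η s - ηβ s| ≤ 2 * max |a - aβ| |b - bβ| := by
  intro s hs
  set M := max |a - aβ| |b - bβ| with hMdef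
  have hM1 : a - aβ ≤ M := (le_abs_self _).trans (le_max_left _ _)
  have hM2 : b - bβ ≤ M := (le_abs_self _).trans (le_max_right _ _)
  have hM : 0 ≤ M := (abs_nonneg _).trans (le_max_left _ _)
  have hi := aux_sol_int hv hS
  have hiβ := aux_sol_int hv hSβ
  obtain ⟨-, hr, -, hl, he, -⟩ := hS
  obtain ⟨-, hrβ, -, hlβ, heβ, -⟩ := hSβ
  have key1 : η s - ηβ s ≤ M := by
    refine aux_max (fun s => η s - ηβ s) (fun τ => (v τ - l τ * bdryNormal a b (η τ)) -
      (v τ - lβ τ * bdryNormal aβ bβ (ηβ τ))) M hM (fun s hs => (hi s hs).sub (hiβ s hs))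
      ?_ ?_ s hs
    · intro s hs
      rw [intervalIntegral.integral_sub (hi s hs) (hiβ s hs), he s hs, heβ s hs]
      ring
    · filter_upwards [hl, hlβ, ae_restrict_mem measurableSet_Ici] with x h1 h2 hx h3
      have r := hr x hx
      have rβ := hrβ x hx
      have e1 : 0 ≤ bdryNormal a b (η x) := by
        unfold bdryNormal
        split_ifs with p q
        · exfalso; linarith [rβ.1]
        · norm_num
        · norm_num
      have e2 : bdryNormal aβ bβ (ηβ x) ≤ 0 := by
        unfold bdryNormal
        split_ifs with p q
        · norm_num
        · exfalso; linarith [r.2]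
        · norm_num
      nlinarith [mul_nonneg h1 e1, mul_nonneg h2 (neg_nonneg.2 e2)]
  have key2 : ηβ s - η s ≤ M := by
    refine aux_max (fun s => ηβ s - η s) (fun τ => (v τ - lβ τ * bdryNormal aβ bβ (ηβ τ)) -
      (v τ - l τ * bdryNormal a b (η τ))) M hM (fun s hs => (hiβ s hs).sub (hi s hs))
      ?_ ?_ s hs
    · intro s hs
      rw [intervalIntegral.integral_sub (hiβ s hs) (hi s hs), he s hs, heβ s hs]
      ring
    · filter_upwards [hl, hlβ, ae_restrict_mem measurableSet_Ici] with x h1 h2 hx h3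
      have r := hr x hx
      have rβ := hrβ x hx
      have e1 : bdryNormal a b (η x) ≤ 0 := by
        unfold bdryNormal
        split_ifs with p q
        · norm_num
        · exfalso; linarith [rβ.2]
        · norm_num
      have e2 : 0 ≤ bdryNormal aβ bβ (ηβ x) := by
        unfold bdryNormal
        split_ifs with p q
        · exfalso; linarith [r.1]
        · norm_num
        · norm_num
      nlinarith [mul_nonneg h2 e2, mul_nonneg h1 (neg_nonneg.2 e1)]
  rw [abs_le]
  constructor <;> linarith
end
end
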